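/- arXiv:1703.08101 — 2 statements merged into one kernel-verified Lean document; each statement's English description precedes it below -/
import Mathlib

section
/- Let u be a non-constant subharmonic function on ℂ. Then for every ε > 0, the averages (1/A(R·𝔻)) ∫_{R𝔻} (log₊ u)^{1+ε} dA tend to +∞ as R → ∞. -/
open MeasureTheory Metric Complex

lemma area_mean (G : ℂ → ℝ) (hG : Continuous G) (c : ℂ) (r A : ℝ) (hr : 0 < r)
    (h : ∀ ρ, 0 < ρ → ρ ≤ r → Real.circleAverage G c ρ = A) :
    ∫ w in closedBall c r, G w = A * (Real.pi * r ^ 2) := by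
  have h1 : ∫ w in closedBall c r, G w = ∫ w, (closedBall (0:ℂ) r).indicator (fun w => G (c + w)) w := by
    rw [← integral_indicator measurableSet_closedBall, ← integral_add_left_eq_self _ c]
    congr 1
    ext w
    simp [Set.indicator, mem_closedBall, dist_eq_norm]
  rw [h1, ← Complex.integral_comp_polarCoord_symm]
  have h2 : ∀ p ∈ Complex.polarCoord.target, p.1 • (closedBall (0:ℂ) r).indicator (fun w => G (c + w)) (Complex.polarCoord.symm p) = (Set.Iic r ×ˢ (Set.univ : Set ℝ)).indicator (fun p : ℝ × ℝ => p.1 * G (circleMap c p.1 p.2)) p := by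
    intro p hp
    have hp1 : 0 < p.1 := hp.1
    have hn : ‖Complex.polarCoord.symm p‖ = p.1 := by
      rw [Complex.norm_polarCoord_symm, abs_of_pos hp1]
    simp only [Set.indicator, mem_closedBall, dist_zero_right, hn, Set.mem_prod, Set.mem_Iic, Set.mem_univ, and_true, smul_eq_mul]
    split_ifs
    · rw [Complex.polarCoord_symm_apply, circleMap, Complex.exp_mul_I, Complex.ofReal_cos, Complex.ofReal_sin]
    · simp
  have hms : MeasurableSet (Complex.polarCoord.target) := by
    rw [Complex.polarCoord_target]; exact measurableSet_Ioi.prod measurableSet_Ioo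
  change ∫ p in Complex.polarCoord.target, _ = _
  rw [setIntegral_congr_fun hms h2, setIntegral_indicator (measurableSet_Iic.prod MeasurableSet.univ),
    Complex.polarCoord_target, Set.prod_inter_prod, Set.inter_univ, Set.Ioi_inter_Iic,
    Measure.volume_eq_prod, setIntegral_prod]
  · have h3 : ∀ ρ ∈ Set.Ioc 0 r, ∫ θ in Set.Ioo (-Real.pi) Real.pi, ρ * G (circleMap c ρ θ) = ρ * (2 * Real.pi * A) := by
      intro ρ hρ
      rw [integral_const_mul, ← h ρ hρ.1 hρ.2, Real.circleAverage_def, smul_eq_mul, mul_inv_cancel_left₀ (by positivity)]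
      rw [← integral_Ioc_eq_integral_Ioo, ← intervalIntegral.integral_of_le (by linarith [Real.pi_pos])]
      have t₀ : (fun θ ↦ G (circleMap c ρ θ)).Periodic (2 * Real.pi) :=
        fun x ↦ by simp [periodic_circleMap c ρ x]
      have := t₀.intervalIntegral_add_eq 0 (-Real.pi)
      rw [zero_add] at this
      rw [this]; congr 2; ring
    rw [setIntegral_congr_fun measurableSet_Ioc h3, integral_mul_const,
      ← intervalIntegral.integral_of_le hr.le, integral_id]
    ring
  · have : IntegrableOn (fun p : ℝ × ℝ => p.1 * G (circleMap c p.1 p.2)) (Set.Icc 0 r ×ˢ Set.Icc (-Real.pi) Real.pi) (volume.prod volume) := by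
      apply ContinuousOn.integrableOn_compact (isCompact_Icc.prod isCompact_Icc)
      apply Continuous.continuousOn
      have : Continuous (fun x : ℝ × ℝ => circleMap c x.1 x.2) := by fun_prop [circleMap]
      fun_prop
    exact this.mono_set (Set.prod_mono Set.Ioc_subset_Icc_self Set.Ioo_subset_Icc_self)

/-- mean equality: continuous u ≤ M on closedBall, u z = M ≤ mean ⇒ u = M. -/
lemma eq_of_mean (u : ℂ → ℝ) (hu : Continuous u) (z : ℂ) (r M : ℝ) (hr : 0 < r)
    (hle : ∀ w ∈ closedBall z r, u w ≤ M) (hm : M * (Real.pi * r ^ 2) ≤ ∫ w in closedBall z r, u w) :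
    ∀ w ∈ ball z r, u w = M := by
  by_contra! hne
  obtain ⟨w, hw, hwM⟩ := hne
  have hvol : volume.real (closedBall z r) = Real.pi * r ^ 2 := by
    simp [Measure.real, Complex.volume_closedBall, hr.le, mul_comm]
  have hi : IntegrableOn u (closedBall z r) := hu.continuousOn.integrableOn_compact (isCompact_closedBall _ _)
  have hc : IntegrableOn (fun _ : ℂ => M) (closedBall z r) := continuousOn_const.integrableOn_compact (isCompact_closedBall _ _)
  have h0 : 0 < ∫ w in closedBall z r, (M - u w) := by
    rw [setIntegral_pos_iff_support_of_nonneg_ae]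
    · have hop : IsOpen ({x | M - u x ≠ 0} ∩ ball z r) :=
        (isOpen_ne_fun (by fun_prop) continuous_const).inter isOpen_ball
      refine lt_of_lt_of_le (hop.measure_pos volume ⟨w, ?_, hw⟩) (measure_mono ?_)
      · simpa [sub_eq_zero] using hwM.symm
      · intro x hx; exact ⟨hx.1, ball_subset_closedBall hx.2⟩
    · filter_upwards [ae_restrict_mem measurableSet_closedBall] with x hx
      simpa using hle x hx
    · exact hc.sub hi
  rw [integral_sub hc hi] at h0
  simp only [setIntegral_const, smul_eq_mul, hvol] at h0
  linarith

lemma sub_int (u : ℂ → ℝ) 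
    (hsub : ∀ z r, 0 < r → u z ≤ ⨍ w in closedBall z r, u w) (z : ℂ) (r : ℝ) (hr : 0 < r) :
    u z * (Real.pi * r ^ 2) ≤ ∫ w in closedBall z r, u w := by
  have hvol : volume.real (closedBall z r) = Real.pi * r ^ 2 := by
    simp [Measure.real, Complex.volume_closedBall, hr.le, mul_comm]
  have := hsub z r hr
  rw [setAverage_eq, hvol, smul_eq_mul, inv_mul_eq_div, le_div_iff₀ (by positivity)] at this
  exact this

lemma log_mean (c : ℂ) (r : ℝ) (hr : 0 < r) (hc : 1 + r ≤ ‖c‖) :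
    ∫ w in closedBall c r, Real.log (max ‖w‖ 1) = Real.log ‖c‖ * (Real.pi * r ^ 2) := by
  apply area_mean
  · apply Continuous.log (by fun_prop)
    intro x; positivity
  · exact hr
  · intro ρ h0 h1
    have hd : ∀ w ∈ closedBall c |ρ|, 1 ≤ ‖w‖ := by
      intro w hw
      rw [abs_of_pos h0, mem_closedBall, dist_eq_norm] at hw
      have := norm_sub_norm_le c w
      rw [norm_sub_rev] at hw
      linarith
    have : Real.circleAverage (fun w : ℂ => Real.log (max ‖w‖ 1)) c ρ = Real.circleAverage (fun w : ℂ => Real.log ‖w‖) c ρ := by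
      apply Real.circleAverage_congr_sphere
      intro w hw
      simp only [max_eq_left (hd w (sphere_subset_closedBall hw))]
    rw [this]
    apply InnerProductSpace.HarmonicOnNhd.circleAverage_eq (f := fun w : ℂ => Real.log ‖w‖)
    intro w hw
    apply AnalyticAt.harmonicAt_log_norm (f := fun w => w) analyticAt_id
    have := hd w hw
    intro h; simp [h] at this; linarith

lemma liouville (u : ℂ → ℝ) (hcont : Continuous u)
    (hsub : ∀ z r, 0 < r → u z ≤ ⨍ w in closedBall z r, u w) (B : ℝ) (hB : ∀ z, u z ≤ B) :
    ∃ c : ℝ, u = fun _ => c := by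
  obtain ⟨z0, hz0, hmax⟩ := (isCompact_closedBall (0:ℂ) 1).exists_isMaxOn ⟨0, by simp⟩ hcont.continuousOn
  have hmax : ∀ w, ‖w‖ ≤ 1 → u w ≤ u z0 := fun w hw => hmax (by simpa using hw)
  have key : ∀ w, 1 < ‖w‖ → u w ≤ u z0 := by
    have hlogc : Continuous (fun w : ℂ => Real.log (max ‖w‖ 1)) := by
      apply Continuous.log (by fun_prop)
      intro x; positivity
    have key1 : ∀ δ > 0, ∀ w : ℂ, u w - δ * Real.log (max ‖w‖ 1) ≤ u z0 := by
      intro δ hδ w0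
      by_contra! hlt
      set v : ℂ → ℝ := fun w => u w - δ * Real.log (max ‖w‖ 1) with hv
      have hvc : Continuous v := by fun_prop
      have hlim : Filter.Tendsto v (Filter.cocompact ℂ) Filter.atBot := by
        have h1 : Filter.Tendsto (fun w : ℂ => max ‖w‖ 1) (Filter.cocompact ℂ) Filter.atTop :=
          Filter.tendsto_atTop_mono (fun w => le_max_left _ _) (tendsto_norm_cocompact_atTop)
        have h2 := (Real.tendsto_log_atTop.comp h1).const_mul_atTop hδ
        have h3 := Filter.tendsto_atBot_add_const_left _ B (Filter.tendsto_neg_atTop_atBot.comp h2)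
        refine Filter.tendsto_atBot_mono (fun w => ?_) h3
        simp only [hv, Function.comp]
        linarith [hB w]
      obtain ⟨z1, hz1⟩ := hvc.exists_forall_ge hlim
      -- the set of maximum points
      have hS : IsCompact {w | v w = v z1} := by
        apply isCompact_of_isClosed_isBounded (isClosed_eq hvc continuous_const)
        have := hlim.eventually (Filter.eventually_lt_atBot (v z1))
        rw [Filter.Eventually, Filter.mem_cocompact] at this
        obtain ⟨t, ht, hts⟩ := this
        refine ht.isBounded.subset fun x hx => ?_
        by_contra hxt
        have : v x < v z1 := hts hxt
        exact this.ne hx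
      obtain ⟨z2, hz2, hmin⟩ := hS.exists_isMinOn ⟨z1, rfl⟩ continuous_norm.continuousOn
      have hz2' : v z2 = v z1 := hz2
      have hn2 : 1 < ‖z2‖ := by
        by_contra! hle
        have h1 := hmax z2 hle
        have h2 : v z2 = u z2 := by simp [hv, max_eq_right hle]
        have := hz1 w0
        linarith
      set r := (‖z2‖ - 1) with hr
      have hr0 : 0 < r := by linarith
      have hmean : v z2 * (Real.pi * r ^ 2) ≤ ∫ w in closedBall z2 r, v w := by
        have hi : IntegrableOn u (closedBall z2 r) := hcont.continuousOn.integrableOn_compact (isCompact_closedBall _ _)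
        have hi2 : IntegrableOn (fun w : ℂ => δ * Real.log (max ‖w‖ 1)) (closedBall z2 r) := 
          (hlogc.const_mul δ).continuousOn.integrableOn_compact (isCompact_closedBall _ _)
        simp only [hv]
        rw [integral_sub hi hi2, integral_const_mul, log_mean z2 r hr0 (by linarith), max_eq_left hn2.le]
        have := sub_int u hsub z2 r hr0
        linarith
      have heq := eq_of_mean v hvc z2 r (v z2) hr0 (fun w _ => hz2' ▸ hz1 w) hmean
      set s : ℝ := 1 - r / (2 * ‖z2‖) with hs
      have hq : r / (2 * ‖z2‖) ≤ 1 / 2 := by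
        rw [div_le_div_iff₀ (by linarith) (by norm_num)]; linarith
      have hq0 : 0 < r / (2 * ‖z2‖) := by positivity
      have h5 := heq ((s : ℂ) * z2) (by
        rw [mem_ball, dist_eq_norm]
        have : (s : ℂ) * z2 - z2 = ((-(r / (2 * ‖z2‖)) : ℝ) : ℂ) * z2 := by
          rw [hs]; push_cast; ring
        rw [this, norm_mul, Complex.norm_real, norm_neg, Real.norm_of_nonneg hq0.le]
        have : r / (2 * ‖z2‖) * ‖z2‖ = r / 2 := by field_simp
        linarith)
      have h6 : ‖z2‖ ≤ ‖(s:ℂ) * z2‖ := hmin (show v _ = v z1 by rw [h5, hz2'])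
      rw [norm_mul, Complex.norm_real, Real.norm_of_nonneg (by linarith)] at h6
      nlinarith
    intro w hw
    by_contra! hlt
    have hL : 0 < Real.log (max ‖w‖ 1) := Real.log_pos (lt_max_of_lt_left hw)
    have := key1 ((u w - u z0) / (2 * Real.log (max ‖w‖ 1))) (by apply div_pos <;> linarith) w
    have h2 : (u w - u z0) / (2 * Real.log (max ‖w‖ 1)) * Real.log (max ‖w‖ 1) = (u w - u z0) / 2 := by
      field_simp
    linarith
  have hall : ∀ w, u w ≤ u z0 := fun w => (le_or_gt ‖w‖ 1).elim (hmax w) (key w)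
  refine ⟨u z0, funext fun w => ?_⟩
  have hr : 0 < dist w z0 + 1 := by positivity
  exact eq_of_mean u hcont z0 _ _ hr (fun w _ => hall w) (sub_int u hsub z0 _ hr) w (by simp)

/-- The layer on which `log u` lies in `(k-1, k+1]`. -/
def layer (u : ℂ → ℝ) (k : ℕ) : Set ℂ :=
  {w | Real.exp ((k:ℝ) - 1) < u w ∧ u w ≤ Real.exp ((k:ℝ) + 1)}

lemma layer_meas (u : ℂ → ℝ) (hu : Continuous u) (k : ℕ) : MeasurableSet (layer u k) :=
  (measurableSet_lt measurable_const hu.measurable).inter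
    (measurableSet_le hu.measurable measurable_const)

lemma domar_step (u : ℂ → ℝ) (hcont : Continuous u)
    (hsub : ∀ z r, 0 < r → u z ≤ ⨍ w in closedBall z r, u w) (z : ℂ) (r : ℝ) (hr : 0 < r) (k : ℕ)
    (hz : Real.exp k ≤ u z) (hle : ∀ w ∈ closedBall z r, u w ≤ Real.exp ((k:ℝ) + 1)) :
    Real.pi * r ^ 2 ≤ 8 * volume.real (closedBall z r ∩ layer u k) := by
  have hvol : volume.real (closedBall z r) = Real.pi * r ^ 2 := by
    simp [Measure.real, Complex.volume_closedBall, hr.le, mul_comm]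
  have hi : IntegrableOn u (closedBall z r) := hcont.continuousOn.integrableOn_compact (isCompact_closedBall _ _)
  have hc : ∀ M : ℝ, IntegrableOn (fun _ : ℂ => M) (closedBall z r) := fun M => continuousOn_const.integrableOn_compact (isCompact_closedBall _ _)
  have hI := (hc (Real.exp ((k:ℝ)+1))).indicator (layer_meas u hcont k)
  have h1 : ∫ w in closedBall z r, u w ≤ ∫ w in closedBall z r, (Real.exp ((k:ℝ)-1) + (layer u k).indicator (fun _ => Real.exp ((k:ℝ)+1)) w) := by
    apply setIntegral_mono_on hi ((hc _).add hI) measurableSet_closedBall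
    intro w hw
    rw [Pi.add_apply]
    by_cases hl : w ∈ layer u k
    · rw [Set.indicator_of_mem hl]
      linarith [hle w hw, Real.exp_pos ((k:ℝ)-1)]
    · rw [Set.indicator_of_notMem hl]
      by_contra! hh
      exact hl ⟨by linarith, hle w hw⟩
  rw [integral_add (hc _) hI, setIntegral_indicator (layer_meas u hcont k)] at h1
  simp only [setIntegral_const, smul_eq_mul, hvol] at h1
  have h2 := sub_int u hsub z r hr
  set m := volume.real (closedBall z r ∩ layer u k)
  have hm : 0 ≤ m := measureReal_nonneg
  set V := Real.pi * r ^ 2 with hV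
  have hV0 : 0 < V := by positivity
  have h3 : Real.exp k * V ≤ u z * V := by gcongr
  have e1 : Real.exp ((k:ℝ)+1) = Real.exp k * Real.exp 1 := Real.exp_add _ _
  have e2 : Real.exp ((k:ℝ)-1) = Real.exp k / Real.exp 1 := Real.exp_sub _ _
  rw [e1, e2] at h1
  have hk := Real.exp_pos k
  have he := Real.exp_one_lt_d9
  have he' := Real.exp_one_gt_d9
  have h4 : Real.exp k * V ≤ Real.exp k * (V / Real.exp 1 + m * Real.exp 1) := by
    calc _ ≤ _ := h3.trans (h2.trans h1)
      _ = _ := by ring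
  have h5 := le_of_mul_le_mul_left h4 hk
  have h6 : V / Real.exp 1 ≤ V / 2 := by gcongr; linarith
  have h7 : m * Real.exp 1 ≤ m * 3 := by gcongr; linarith
  linarith

/-- the integrand -/
lemma logp_eq (x : ℝ) : max (Real.log (max x 0)) 0 = Real.log (max x 1) := by
  rcases le_total x 1 with h | h
  · rw [max_eq_right h, Real.log_one]
    exact max_eq_right (Real.log_nonpos (le_max_right _ _) (max_le h zero_le_one))
  · rw [max_eq_left h, max_eq_left (by linarith : (0:ℝ) ≤ x), max_eq_left (Real.log_nonneg h)]

lemma layer_sum_pt (u : ℂ → ℝ) (p : ℝ) (hp : 0 < p) (K n : ℕ) (hK : 2 ≤ K) (w : ℂ) :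
    ∑ j ∈ Finset.range n, (layer u (K + j)).indicator (fun _ => (((K + j : ℕ) : ℝ)) ^ p) w
      ≤ 2 * (2 ^ p * (Real.log (max (u w) 1)) ^ p) := by
  classical
  set L := Real.log (max (u w) 1) with hL
  have hL0 : 0 ≤ L := Real.log_nonneg (le_max_right _ _)
  have hmem : ∀ j, w ∈ layer u (K + j) → ((K + j : ℕ) : ℝ) - 1 < L ∧ L ≤ ((K + j : ℕ) : ℝ) + 1 := by
    intro j hj
    obtain ⟨h1, h2⟩ := hj
    have hk : (2:ℝ) ≤ ((K + j : ℕ) : ℝ) := by exact_mod_cast (by omega : 2 ≤ K + j)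
    have h3 : 1 ≤ u w := by
      have := Real.one_le_exp (show (0:ℝ) ≤ ((K + j : ℕ) : ℝ) - 1 by linarith)
      linarith
    rw [hL, max_eq_left h3]
    exact ⟨(Real.lt_log_iff_exp_lt (by linarith)).2 h1, (Real.log_le_iff_le_exp (by linarith)).2 h2⟩
  have hsum : ∑ j ∈ Finset.range n, (layer u (K + j)).indicator (fun _ => (((K + j : ℕ) : ℝ)) ^ p) w
      = ∑ j ∈ (Finset.range n).filter (fun j => w ∈ layer u (K + j)), (((K + j : ℕ) : ℝ)) ^ p := by
    rw [Finset.sum_filter]; rfl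
  rw [hsum]
  have hcard : ((Finset.range n).filter (fun j => w ∈ layer u (K + j))).card ≤ 2 := by
    have : (((Finset.range n).filter (fun j => w ∈ layer u (K + j))).image (fun j => K + j)) ⊆ {⌈L - 1⌉₊, ⌈L - 1⌉₊ + 1} := by
      intro x hx
      obtain ⟨j, hj, rfl⟩ := Finset.mem_image.1 hx
      obtain ⟨h1, h2⟩ := hmem j (Finset.mem_filter.1 hj).2
      have h3 : ⌈L - 1⌉₊ ≤ K + j := Nat.ceil_le.2 (by linarith)
      have h4 : K + j < ⌈L - 1⌉₊ + 2 := by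
        have := Nat.le_ceil (L - 1)
        have h5 : ((K + j : ℕ) : ℝ) < ((⌈L - 1⌉₊ + 2 : ℕ) : ℝ) := by push_cast at *; linarith
        exact_mod_cast h5
      simp only [Finset.mem_insert, Finset.mem_singleton]
      omega
    have h2 := Finset.card_le_card this
    rw [Finset.card_image_of_injective _ (add_right_injective K)] at h2
    exact h2.trans Finset.card_le_two
  have hpos : (0:ℝ) ≤ 2 ^ p * L ^ p := by positivity
  calc _ ≤ ((Finset.range n).filter (fun j => w ∈ layer u (K + j))).card • (2 ^ p * L ^ p) := by
        apply Finset.sum_le_card_nsmul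
        intro j hj
        obtain ⟨h1, h2⟩ := hmem j (Finset.mem_filter.1 hj).2
        have hk : (2:ℝ) ≤ ((K + j : ℕ) : ℝ) := by exact_mod_cast (by omega : 2 ≤ K + j)
        rw [← Real.mul_rpow (by norm_num) hL0]
        apply Real.rpow_le_rpow (by linarith) (by linarith) hp.le
    _ ≤ _ := by
        rw [nsmul_eq_mul]
        gcongr
        exact_mod_cast hcard

lemma layer_sum (u : ℂ → ℝ) (hcont : Continuous u) (p : ℝ) (hp : 0 < p) (K n : ℕ) (hK : 2 ≤ K) (R : ℝ) :
    ∑ j ∈ Finset.range n, (((K + j : ℕ) : ℝ)) ^ p * volume.real (ball (0:ℂ) R ∩ layer u (K + j))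
      ≤ 2 * (2 ^ p * ∫ w in ball (0:ℂ) R, (Real.log (max (u w) 1)) ^ p) := by
  have hc : ∀ M : ℝ, IntegrableOn (fun _ : ℂ => M) (ball 0 R) := fun M => 
    (continuousOn_const.integrableOn_compact (isCompact_closedBall _ _)).mono_set ball_subset_closedBall
  have hfc : Continuous (fun w => (Real.log (max (u w) 1)) ^ p) := by
    apply Continuous.rpow_const
    · apply Continuous.log (by fun_prop)
      intro x; positivity
    · intro x; right; exact hp.le
  have hf : IntegrableOn (fun w => (Real.log (max (u w) 1)) ^ p) (ball 0 R) :=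
    (hfc.continuousOn.integrableOn_compact (isCompact_closedBall _ _)).mono_set ball_subset_closedBall
  have hI : ∀ j : ℕ, IntegrableOn ((layer u (K + j)).indicator (fun _ => (((K + j : ℕ) : ℝ)) ^ p)) (ball 0 R) :=
    fun j => (hc _).indicator (layer_meas u hcont _)
  have h1 : ∑ j ∈ Finset.range n, (((K + j : ℕ) : ℝ)) ^ p * volume.real (ball (0:ℂ) R ∩ layer u (K + j))
     = ∫ w in ball (0:ℂ) R, ∑ j ∈ Finset.range n, (layer u (K + j)).indicator (fun _ => (((K + j : ℕ) : ℝ)) ^ p) w := by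
    rw [integral_finsetSum _ (fun j _ => hI j)]
    refine Finset.sum_congr rfl fun j _ => ?_
    rw [setIntegral_indicator (layer_meas u hcont _), setIntegral_const, smul_eq_mul, mul_comm]
  rw [h1, ← integral_const_mul, ← integral_const_mul]
  exact integral_mono (integrable_finsetSum _ (fun j _ => hI j)) ((hf.const_mul _).const_mul _)
    (layer_sum_pt u p hp K n hK)

lemma domar (u : ℂ → ℝ) (hcont : Continuous u)
    (hsub : ∀ z r, 0 < r → u z ≤ ⨍ w in closedBall z r, u w) (p : ℝ) (hp : 1 < p) (M : ℝ) (hM : 0 < M) :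
    ∃ B : ℝ, ∀ R > 0, ∫ w in ball (0:ℂ) R, (Real.log (max (u w) 1)) ^ p ≤ M * R ^ 2 →
      ∀ z, ‖z‖ ≤ R / 2 → u z ≤ B := by
  set C : ℝ := 2 * (2 ^ p * M) with hC
  have hC0 : 0 < C := by positivity
  set t : ℝ := 1 / (8 * C) with ht
  have ht0 : 0 < t := by positivity
  have htC : t * C = 1 / 8 := by rw [ht]; field_simp
  have hsm : Summable (fun k : ℕ => ((k:ℝ) ^ p)⁻¹) := Real.summable_nat_rpow_inv.2 hp
  have htail := tendsto_sum_nat_add (fun k : ℕ => ((k:ℝ) ^ p)⁻¹)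
  obtain ⟨K, hKt, hK⟩ := ((htail.eventually (gt_mem_nhds (show (0:ℝ) < t / 8 by positivity))).and
    (Filter.eventually_ge_atTop 2)).exists
  have htl : ∀ n, ∑ j ∈ Finset.range n, (((K + j : ℕ):ℝ) ^ p)⁻¹ ≤ t / 8 := by
    intro n
    refine le_trans ?_ hKt.le
    have := ((summable_nat_add_iff K).2 hsm).sum_le_tsum (Finset.range n) (fun j _ => by positivity)
    simpa [add_comm] using this
  refine ⟨Real.exp K, fun R hR hint z0 hz0 => ?_⟩
  by_contra! hlt
  set m : ℕ → ℝ := fun k => volume.real (ball (0:ℂ) R ∩ layer u k) with hm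
  have hm0 : ∀ k, 0 ≤ m k := fun k => measureReal_nonneg
  set ρ : ℕ → ℝ := fun k => t * ((k:ℝ) ^ p * m k) / R + R * ((k:ℝ) ^ p)⁻¹ / t with hρ
  have hρsum : ∀ n, ∑ j ∈ Finset.range n, ρ (K + j) ≤ R / 4 := by
    intro n
    simp only [hρ, Finset.sum_add_distrib, ← Finset.sum_div, ← Finset.mul_sum]
    have h1 := layer_sum u hcont p (by linarith) K n hK R
    have h2 : t * ∑ j ∈ Finset.range n, (((K + j : ℕ):ℝ) ^ p * m (K + j)) / R ≤ R / 8 := by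
      rw [← Finset.sum_div, mul_div_assoc', div_le_iff₀ hR]
      calc _ ≤ t * (2 * (2 ^ p * (M * R ^ 2))) := by
            gcongr
            refine h1.trans ?_
            gcongr
        _ = (t * C) * R ^ 2 := by rw [hC]; ring
        _ = _ := by rw [htC]; ring
    have h3 : R * (∑ j ∈ Finset.range n, (((K + j : ℕ):ℝ) ^ p)⁻¹) / t ≤ R / 8 := by
      rw [div_le_iff₀ ht0]
      have := mul_le_mul_of_nonneg_left (htl n) hR.le
      linarith
    rw [← Finset.sum_div, mul_div_assoc'] at h2
    linarith
  have hρpos : ∀ k : ℕ, 0 < k → 0 < ρ k := by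
    intro k hk
    have : (0:ℝ) < k := by exact_mod_cast hk
    have := hm0 k
    simp only [hρ]; positivity
  have hρsq : ∀ k : ℕ, 0 < k → 4 * m k ≤ ρ k ^ 2 := by
    intro k hk
    have h0 : (0:ℝ) < k := by exact_mod_cast hk
    have h1 : (0:ℝ) < (k:ℝ) ^ p := by positivity
    have h2 : (t * ((k:ℝ) ^ p * m k) / R) * (R * ((k:ℝ) ^ p)⁻¹ / t) = m k := by
      field_simp
    simp only [hρ]
    nlinarith [sq_nonneg ((t * ((k:ℝ) ^ p * m k) / R) - (R * ((k:ℝ) ^ p)⁻¹ / t))]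
  have hchain : ∀ n : ℕ, ∃ z, Real.exp ((K + n : ℕ) : ℝ) ≤ u z ∧
      ‖z‖ ≤ R / 2 + ∑ j ∈ Finset.range n, ρ (K + j) := by
    intro n
    induction n with
    | zero => exact ⟨z0, by simpa using hlt.le, by simpa using hz0⟩
    | succ n ih =>
      obtain ⟨z, hz, hzn⟩ := ih
      have hk : 0 < K + n := by omega
      have hr := hρpos _ hk
      have hs := hρsum (n + 1)
      rw [Finset.sum_range_succ] at hs ⊢
      have hex : ∃ w ∈ closedBall z (ρ (K + n)), Real.exp (((K + n : ℕ):ℝ) + 1) < u w := by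
        by_contra! hno
        have h1 := domar_step u hcont hsub z _ hr (K + n) hz hno
        have hsubset : closedBall z (ρ (K + n)) ⊆ ball 0 R := by
          intro w hw
          rw [mem_closedBall, dist_eq_norm] at hw
          rw [mem_ball_zero_iff]
          have := norm_le_norm_add_norm_sub' w z
          linarith
        have h2 : volume.real (closedBall z (ρ (K + n)) ∩ layer u (K + n)) ≤ m (K + n) :=
          measureReal_mono (Set.inter_subset_inter_left _ hsubset)
            (measure_ne_top_of_subset Set.inter_subset_left measure_ball_lt_top.ne)
        have h3 := hρsq _ hk
        have h4 : 0 < ρ (K + n) ^ 2 := by positivity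
        nlinarith [Real.pi_gt_three]
      obtain ⟨w, hw, hwu⟩ := hex
      refine ⟨w, ?_, ?_⟩
      · push_cast at hwu ⊢
        rw [← add_assoc]; exact hwu.le
      · rw [mem_closedBall, dist_eq_norm] at hw
        have := norm_le_norm_add_norm_sub' w z
        linarith
  obtain ⟨b, hb⟩ := (isCompact_closedBall (0:ℂ) R).bddAbove_image hcont.continuousOn
  obtain ⟨n, hn⟩ := exists_nat_gt b
  obtain ⟨z, hz, hzn⟩ := hchain n
  have h1 : u z ≤ b := hb ⟨z, by rw [mem_closedBall_zero_iff]; linarith [hρsum n], rfl⟩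
  have h2 := Real.add_one_le_exp ((K + n : ℕ) : ℝ)
  push_cast at h2 hz
  have : (0:ℝ) ≤ K := by positivity
  linarith

theorem stmt4 (u : ℂ → ℝ) (hcont : Continuous u)
    (hsub : ∀ z r, 0 < r → u z ≤ ⨍ w in closedBall z r, u w)
    (hnc : ¬∃ c : ℝ, u = fun _ => c) (ε : ℝ) (hε : 0 < ε) :
    Filter.Tendsto
      (fun R : ℝ => (volume (ball (0:ℂ) R)).toReal⁻¹ *
        ∫ z in ball (0:ℂ) R, (max (Real.log (max (u z) 0)) 0) ^ (1 + ε))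
      Filter.atTop Filter.atTop := by
  rw [Filter.tendsto_atTop]
  intro M
  by_contra hev
  rw [Filter.not_eventually] at hev
  apply hnc
  have hM : (0:ℝ) < max M 1 * Real.pi := by positivity
  obtain ⟨B, hB⟩ := domar u hcont hsub (1 + ε) (by linarith) (max M 1 * Real.pi) hM
  refine liouville u hcont hsub B fun z => ?_
  obtain ⟨R, hR1, hR2⟩ := (hev.and_eventually (Filter.eventually_ge_atTop (2 * ‖z‖ + 1))).exists
  have hR : 0 < R := by linarith [norm_nonneg z]
  refine hB R hR ?_ z (by linarith)
  simp only [logp_eq] at hR1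
  have hvol : (volume (ball (0:ℂ) R)).toReal = Real.pi * R ^ 2 := by
    simp [Complex.volume_ball, hR.le, mul_comm]
  rw [hvol, not_le, inv_mul_lt_iff₀ (by positivity)] at hR1
  have : Real.pi * R ^ 2 * M ≤ Real.pi * R ^ 2 * max M 1 := by gcongr; exact le_max_left _ _
  linarith
end

section
/- Let h(x+iy) = cosh(x)·cos(y) for |y| < π/2 and h = 0 otherwise. Then h is subharmonic on ℂ. -/
open MeasureTheory Metric Complex

/-- `h(x+iy) = cosh x · cos y` on the strip `|y| < π/2`, and `0` outside of it. -/
noncomputable def stripFun (z : ℂ) : ℝ :=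
  if |z.im| < Real.pi / 2 then Real.cosh z.re * Real.cos z.im else 0

/-- the harmonic function. -/
noncomputable def harmFun (z : ℂ) : ℝ := Real.cosh z.re * Real.cos z.im

/-- truncated cosine minus cosine -/
noncomputable def cosGap (y : ℝ) : ℝ :=
  Real.cos (max (-(Real.pi / 2)) (min (Real.pi / 2) y)) - Real.cos y

lemma stripFun_eq (z : ℂ) : stripFun z =
    Real.cosh z.re * Real.cos (max (-(Real.pi / 2)) (min (Real.pi / 2) z.im)) := by
  have hpi := Real.pi_pos
  unfold stripFun
  split_ifs with h
  · rw [abs_lt] at h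
    rw [min_eq_right h.2.le, max_eq_right h.1.le]
  · rw [abs_lt, not_and_or, not_lt, not_lt] at h
    rcases h with h | h
    · rw [min_eq_right (by linarith), max_eq_left h]; simp
    · rw [min_eq_left h, max_eq_right (by linarith)]; simp

lemma stripFun_continuous : Continuous stripFun := by
  have : stripFun = fun z : ℂ => Real.cosh z.re *
      Real.cos (max (-(Real.pi / 2)) (min (Real.pi / 2) z.im)) := funext stripFun_eq
  rw [this]
  fun_prop

lemma harmFun_continuous : Continuous harmFun := by
  unfold harmFun
  fun_prop

lemma cosGap_continuous : Continuous cosGap := by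
  unfold cosGap
  fun_prop

lemma stripFun_sub (z : ℂ) : stripFun z - harmFun z = Real.cosh z.re * cosGap z.im := by
  rw [stripFun_eq, harmFun, cosGap]; ring

lemma cosGap_neg (y : ℝ) : cosGap (-y) = cosGap y := by
  have hpi := Real.pi_pos
  unfold cosGap
  rw [Real.cos_neg]
  congr 1
  rw [← Real.cos_neg, ← min_neg_neg, ← max_neg_neg, neg_neg, neg_neg, min_max_distrib_left,
    min_eq_right (a := Real.pi / 2) (b := -(Real.pi / 2)) (by linarith)]

lemma cosGap_zero {y : ℝ} (h1 : -(Real.pi / 2) ≤ y) (h2 : y ≤ Real.pi / 2) : cosGap y = 0 := by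
  unfold cosGap
  rw [min_eq_right h2, max_eq_right h1, sub_self]

lemma cosGap_ge {y : ℝ} (h2 : Real.pi / 2 ≤ y) : cosGap y = - Real.cos y := by
  have hpi := Real.pi_pos
  unfold cosGap
  rw [min_eq_left h2, max_eq_right (by linarith)]; simp

lemma cosGap_half {y b : ℝ} (h1 : -(Real.pi / 2) ≤ y) (h2 : y ≤ Real.pi / 2) (hb : y ≤ b) :
    0 ≤ ∫ t in y..b, cosGap t := by
  have hi : ∀ a b, IntervalIntegrable cosGap volume a b :=
    fun a b => cosGap_continuous.intervalIntegrable a b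
  have key : ∀ c, y ≤ c → c ≤ Real.pi / 2 → ∫ t in y..c, cosGap t = 0 := by
    intro c hc hc'
    rw [intervalIntegral.integral_congr (g := fun _ => (0 : ℝ))]
    · simp
    · intro t ht
      rw [Set.uIcc_of_le hc] at ht
      exact cosGap_zero (h1.trans ht.1) (ht.2.trans hc')
  rcases le_total b (Real.pi / 2) with h | h
  · rw [key b hb h]
  · rw [← intervalIntegral.integral_add_adjacent_intervals (hi y (Real.pi / 2)) (hi _ b),
      key _ h2 le_rfl, zero_add]
    rw [intervalIntegral.integral_congr (g := fun t => - Real.cos t)]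
    · simp only [intervalIntegral.integral_neg, integral_cos, Real.sin_pi_div_two]
      linarith [Real.sin_le_one b]
    · intro t ht
      rw [Set.uIcc_of_le h] at ht
      exact cosGap_ge ht.1

lemma cosGap_chord {y s : ℝ} (h1 : -(Real.pi / 2) ≤ y) (h2 : y ≤ Real.pi / 2) (hs : 0 ≤ s) :
    0 ≤ ∫ t in Set.Icc (y - s) (y + s), cosGap t := by
  have hi : ∀ a b, IntervalIntegrable cosGap volume a b :=
    fun a b => cosGap_continuous.intervalIntegrable a b
  rw [integral_Icc_eq_integral_Ioc, ← intervalIntegral.integral_of_le (by linarith),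
    ← intervalIntegral.integral_add_adjacent_intervals (hi _ y) (hi y _)]
  have A := cosGap_half h1 h2 (b := y + s) (by linarith)
  have B := cosGap_half (y := -y) (b := -(y - s)) (by linarith) (by linarith) (by linarith)
  have C : ∫ t in (-y)..(-(y - s)), cosGap t = ∫ t in (y - s)..y, cosGap t := by
    rw [← intervalIntegral.integral_comp_neg]
    simp_rw [cosGap_neg]
  linarith

lemma gap_nonneg {z : ℂ} (hz : |z.im| < Real.pi / 2) (r : ℝ) (hr : 0 < r) :
    0 ≤ ∫ w in closedBall z r, (stripFun w - harmFun w) := by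
  rw [abs_lt] at hz
  have hint : IntegrableOn (fun w => stripFun w - harmFun w) (closedBall z r) :=
    (stripFun_continuous.sub harmFun_continuous).continuousOn.integrableOn_compact
      (isCompact_closedBall z r)
  rw [← integrable_indicator_iff measurableSet_closedBall] at hint
  rw [← integral_indicator measurableSet_closedBall]
  have mp := Complex.volume_preserving_equiv_real_prod.symm
  rw [← mp.integral_comp measurableEquivRealProd.symm.measurableEmbedding]
  have hint2 := (mp.integrable_comp_emb
    measurableEquivRealProd.symm.measurableEmbedding).2 hint
  rw [Measure.volume_eq_prod] at hint2 ⊢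
  simp only [Function.comp_def] at hint2
  rw [integral_prod _ hint2]
  refine integral_nonneg fun x => ?_
  simp only [Complex.measurableEquivRealProd_symm_apply]
  by_cases hx : (x - z.re) ^ 2 ≤ r ^ 2
  · set s := √(r ^ 2 - (x - z.re) ^ 2) with hs
    have hs2 : s ^ 2 = r ^ 2 - (x - z.re) ^ 2 := Real.sq_sqrt (by linarith)
    have hs0 : 0 ≤ s := Real.sqrt_nonneg _
    have : ∀ y : ℝ, (closedBall z r).indicator (fun w => stripFun w - harmFun w) ⟨x, y⟩ =
        (Set.Icc (z.im - s) (z.im + s)).indicator (fun y => Real.cosh x * cosGap y) y := by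
      intro y
      have hm : ((⟨x, y⟩ : ℂ) ∈ closedBall z r) ↔ y ∈ Set.Icc (z.im - s) (z.im + s) := by
        rw [mem_closedBall, Complex.dist_eq_re_im, Real.sqrt_le_left hr.le]
        have e : y ∈ Set.Icc (z.im - s) (z.im + s) ↔ |y - z.im| ≤ s := by
          rw [abs_le, Set.mem_Icc]
          constructor <;> rintro ⟨h, h'⟩ <;> constructor <;> linarith
        rw [e, ← sq_le_sq₀ (abs_nonneg _) hs0, sq_abs, hs2]
        constructor <;> intro h <;> simp only at h ⊢ <;> linarith
      by_cases h : y ∈ Set.Icc (z.im - s) (z.im + s)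
      · rw [Set.indicator_of_mem h, Set.indicator_of_mem (hm.2 h), stripFun_sub]
      · rw [Set.indicator_of_notMem h, Set.indicator_of_notMem (fun h' => h (hm.1 h'))]
    simp_rw [this]
    rw [integral_indicator measurableSet_Icc, integral_const_mul]
    exact mul_nonneg (Real.cosh_pos x).le (cosGap_chord hz.1.le hz.2.le hs0)
  · have : ∀ y : ℝ, (closedBall z r).indicator (fun w => stripFun w - harmFun w) ⟨x, y⟩ = 0 := by
      intro y
      apply Set.indicator_of_notMem
      rw [mem_closedBall, Complex.dist_eq_re_im, Real.sqrt_le_left hr.le]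
      simp only
      nlinarith [sq_nonneg (y - z.im)]
    simp_rw [this]
    simp

lemma harmFun_eq_re (z : ℂ) : harmFun z = (Complex.cosh z).re := by
  conv_rhs => rw [← Complex.re_add_im z, Complex.cosh_add, Complex.cosh_mul_I, Complex.sinh_mul_I]
  rw [← Complex.ofReal_cosh, ← Complex.ofReal_cos, ← Complex.ofReal_sinh, ← Complex.ofReal_sin]
  simp only [harmFun, Complex.add_re, Complex.mul_re, Complex.ofReal_re, Complex.ofReal_im,
    Complex.mul_im, Complex.I_re, Complex.I_im]
  ring

lemma harmFun_circle (z : ℂ) (ρ : ℝ) :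
    ∫ θ in Set.Ioo (-Real.pi) Real.pi, (harmFun (circleMap z ρ θ) - harmFun z) = 0 := by
  have hpi := Real.pi_pos
  have hav : Real.circleAverage harmFun z ρ = harmFun z := by
    have h1 : Real.circleAverage Complex.cosh z ρ = Complex.cosh z :=
      DiffContOnCl.circleAverage Complex.differentiable_cosh.diffContOnCl
    have h2 := Complex.reCLM.circleAverage_comp_comm (f := Complex.cosh) (c := z) (R := ρ)
      (Complex.continuous_cosh.continuousOn.circleIntegrable')
    rw [h1] at h2
    have h3 : harmFun = Complex.reCLM ∘ Complex.cosh := by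
      funext w; simp [harmFun_eq_re]
    rw [h3, h2]; rfl
  have hc : Continuous fun θ => harmFun (circleMap z ρ θ) :=
    harmFun_continuous.comp (continuous_circleMap z ρ)
  rw [← integral_Ioc_eq_integral_Ioo, ← intervalIntegral.integral_of_le (by linarith),
    intervalIntegral.integral_sub (hc.intervalIntegrable _ _) (by simp)]
  have hp : Function.Periodic (fun θ => harmFun (circleMap z ρ θ)) (2 * Real.pi) := by
    intro θ
    simp only
    rw [periodic_circleMap z ρ θ]
  have hh := hp.intervalIntegral_add_eq (-Real.pi) 0
  rw [show -Real.pi + 2 * Real.pi = Real.pi by ring, zero_add] at hh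
  rw [hh]
  rw [Real.circleAverage_def, smul_eq_mul] at hav
  rw [intervalIntegral.integral_const, ← hav]
  simp only [smul_eq_mul]
  field_simp
  ring

lemma harm_area (z : ℂ) (r : ℝ) :
    ∫ w in closedBall z r, (harmFun w - harmFun z) = 0 := by
  rw [← integral_indicator measurableSet_closedBall, ← integral_add_left_eq_self _ z,
    ← Complex.integral_comp_polarCoord_symm]
  by_cases hint : IntegrableOn (fun p : ℝ × ℝ => p.1 •
    (closedBall z r).indicator (fun w => harmFun w - harmFun z)
      (z + Complex.polarCoord.symm p)) polarCoord.target
  · rw [polarCoord_target] at hint ⊢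
    rw [Measure.volume_eq_prod] at hint ⊢
    rw [setIntegral_prod _ hint]
    apply setIntegral_eq_zero_of_forall_eq_zero
    intro ρ hρ
    have hρ' : 0 < ρ := hρ
    have hcm : ∀ θ : ℝ, z + Complex.polarCoord.symm (ρ, θ) = circleMap z ρ θ := by
      intro θ
      rw [Complex.polarCoord_symm_apply, circleMap, Complex.exp_mul_I]
      simp
    simp only [hcm]
    rw [integral_smul]
    by_cases h : ρ ≤ r
    · have : ∀ θ : ℝ, (closedBall z r).indicator (fun w => harmFun w - harmFun z)
          (circleMap z ρ θ) = harmFun (circleMap z ρ θ) - harmFun z := by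
        intro θ
        apply Set.indicator_of_mem
        simp [circleMap, abs_of_pos hρ', h]
      simp_rw [this]
      rw [harmFun_circle, smul_zero]
    · have : ∀ θ : ℝ, (closedBall z r).indicator (fun w => harmFun w - harmFun z)
          (circleMap z ρ θ) = 0 := by
        intro θ
        apply Set.indicator_of_notMem
        simpa [circleMap, abs_of_pos hρ'] using h
      simp_rw [this]
      simp
  · exact integral_undef hint

/-- `stripFun` is subharmonic on all of `ℂ`: it is continuous and satisfies the
sub-mean-value inequality on every closed disk. -/
theorem stmt11 :
    Continuous stripFun ∧
      ∀ z : ℂ, ∀ r : ℝ, 0 < r → stripFun z ≤ ⨍ w in closedBall z r, stripFun w := by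
  refine ⟨stripFun_continuous, fun z r hr => ?_⟩
  rw [setAverage_eq, smul_eq_mul]
  by_cases hz : |z.im| < Real.pi / 2
  · have hzz : stripFun z = harmFun z := by simp [stripFun, harmFun, hz]
    have hI : ∀ f : ℂ → ℝ, Continuous f → IntegrableOn f (closedBall z r) := fun f hf =>
      hf.continuousOn.integrableOn_compact (isCompact_closedBall z r)
    have h1 := gap_nonneg hz r hr
    have h2 := harm_area z r
    rw [integral_sub (hI _ stripFun_continuous) (hI _ harmFun_continuous)] at h1
    rw [integral_sub (hI _ harmFun_continuous) (hI _ continuous_const), setIntegral_const,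
      smul_eq_mul] at h2
    have hv : 0 < volume.real (closedBall z r) :=
      ENNReal.toReal_pos (measure_closedBall_pos volume z hr).ne' measure_closedBall_lt_top.ne
    rw [hzz, inv_mul_eq_div, le_div_iff₀ hv]
    linarith
  · have h0 : stripFun z = 0 := by simp [stripFun, hz]
    rw [h0]
    refine mul_nonneg (by positivity) (integral_nonneg fun w => ?_)
    simp only [Pi.zero_apply, stripFun]
    split_ifs with h
    · rw [abs_lt] at h
      exact mul_nonneg (Real.cosh_pos _).le (Real.cos_nonneg_of_neg_pi_div_two_le_of_le
        (by linarith [h.1]) h.2.le)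
    · exact le_rfl
end
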